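/- arXiv:2206.13725 — 2 statements merged into one kernel-verified Lean document; each statement's English description precedes it below -/
import Mathlib

section
/- Let n ≥ 1, let 1 ≤ m < n, and consider the n-globe complex G(n). Suppose given x_m ∈ G(n)_m* with x_m ≠ 0 and, for each 0 ≤ k ≤ m−1 and ε ∈ {0,1}, elements x_k^ε ∈ G(n)_k*, such that: d(x_m) = x_{m−1}^1 − x_{m−1}^0; d(x_k^0) = d(x_k^1) = x_{k−1}^1 − x_{k−1}^0 for all 1 ≤ k ≤ m−1; and e(x_0^0) = e(x_0^1) = 1. Then x_m ∈ {β_m, τ_m}, and x_k^0 = β_k, x_k^1 = τ_k for all 0 ≤ k ≤ m−1. (Hence the ω-category ν(λ(n̄)) has exactly two nondegenerate m-cells for each 0 < m < n.) -/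
/-- The basis of the `n`-globe complex `G(n) = λ(n̄)`: a top generator `υ` in degree `n`
and generators `β_k, τ_k` in each degree `k < n`. -/
inductive GlobeBasis (n : ℕ) : Type
  | top : GlobeBasis n
  | β : Fin n → GlobeBasis n
  | τ : Fin n → GlobeBasis n
  deriving DecidableEq

/-- The underlying graded abelian group of the `n`-globe complex: the free abelian
group on `GlobeBasis n`. -/
abbrev Globe (n : ℕ) : Type := GlobeBasis n →₀ ℤ

/-- The degree of a basis element of `G(n)`. -/
def degG (n : ℕ) : GlobeBasis n → ℕ
  | .top => n
  | .β k => k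
  | .τ k => k

/-- The differential of `G(n)` on basis elements:
`d(υ) = τ_{n-1} - β_{n-1}` and `d(β_k) = d(τ_k) = τ_{k-1} - β_{k-1}` for `k ≥ 1`
(`0` in degree `0`). -/
noncomputable def dGB (n : ℕ) : GlobeBasis n → Globe n
  | .top =>
      if h : 0 < n then
        Finsupp.single (GlobeBasis.τ ⟨n - 1, by omega⟩) 1
          - Finsupp.single (GlobeBasis.β ⟨n - 1, by omega⟩) 1
      else 0
  | .β k =>
      if h : 0 < (k : ℕ) then
        Finsupp.single (GlobeBasis.τ ⟨(k : ℕ) - 1, lt_of_le_of_lt (Nat.sub_le _ _) k.isLt⟩) 1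
          - Finsupp.single (GlobeBasis.β ⟨(k : ℕ) - 1, lt_of_le_of_lt (Nat.sub_le _ _) k.isLt⟩) 1
      else 0
  | .τ k =>
      if h : 0 < (k : ℕ) then
        Finsupp.single (GlobeBasis.τ ⟨(k : ℕ) - 1, lt_of_le_of_lt (Nat.sub_le _ _) k.isLt⟩) 1
          - Finsupp.single (GlobeBasis.β ⟨(k : ℕ) - 1, lt_of_le_of_lt (Nat.sub_le _ _) k.isLt⟩) 1
      else 0

/-- The differential of the globe complex `G(n)`, as a `ℤ`-linear endomorphism of the
free abelian group on the graded basis. -/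
noncomputable def DG (n : ℕ) : Globe n →ₗ[ℤ] Globe n :=
  Finsupp.linearCombination ℤ (dGB n)

/-- `memPos n k x` says that `x` lies in the degree-`k` positivity submonoid `G(n)_k*`:
`x` is homogeneous of degree `k` and has nonnegative coordinates. -/
def memPos (n k : ℕ) (x : Globe n) : Prop :=
  (∀ b ∈ x.support, degG n b = k) ∧ ∀ b, 0 ≤ x b

/-- The augmentation `e : G(n)_0 → ℤ`, `e(a·β_0 + c·τ_0) = a + c` (extended by the
degree-`0` coordinates to the whole group). -/
noncomputable def augG (n : ℕ) (x : Globe n) : ℤ :=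
  if h : 0 < n then x (GlobeBasis.β ⟨0, h⟩) + x (GlobeBasis.τ ⟨0, h⟩) else 0

/-- A positive element of degree `k < n` is a nonnegative combination of `β_k` and `τ_k`. -/
theorem memPos.eq_single_add_single {n k : ℕ} {x : Globe n} (hx : memPos n k x) (hk : k < n) :
    ∃ a c : ℤ, 0 ≤ a ∧ 0 ≤ c ∧
      x = Finsupp.single (GlobeBasis.β ⟨k, hk⟩) a + Finsupp.single (GlobeBasis.τ ⟨k, hk⟩) c := by
  refine ⟨x (.β ⟨k, hk⟩), x (.τ ⟨k, hk⟩), hx.2 _, hx.2 _, ?_⟩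
  have vanish : ∀ b, degG n b ≠ k → x b = 0 := fun b hb => by
    by_contra h
    exact hb (hx.1 b (Finsupp.mem_support_iff.2 h))
  ext b
  rcases b with _ | j | j
  · simpa using vanish .top (by simp only [degG]; omega)
  all_goals
    by_cases hj : j = ⟨k, hk⟩
    · subst hj
      simp
    · refine (vanish _ ?_).trans ?_
      · exact fun h => hj (Fin.ext h)
      · simp [Ne.symm hj]

theorem DG_single_add_single {n k : ℕ} (hk : k + 1 < n) (a c : ℤ) :
    DG n (Finsupp.single (GlobeBasis.β ⟨k + 1, hk⟩) a +
        Finsupp.single (GlobeBasis.τ ⟨k + 1, hk⟩) c) =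
      Finsupp.single (GlobeBasis.τ ⟨k, by omega⟩) (a + c) -
        Finsupp.single (GlobeBasis.β ⟨k, by omega⟩) (a + c) := by
  simp only [DG, map_add, Finsupp.linearCombination_single, dGB, Nat.succ_pos, dite_true,
    Nat.add_sub_cancel, ← add_smul]
  simp [smul_sub]

/-- Let `s k` be the coefficient sum of `y k 0`. It is positive in every degree (downward from
degree `m`) and hence equal to `1` in every degree (upward from degree `0`). -/
theorem globe_cell_coeffs {n m : ℕ} (hmn : m < n) {y : ℕ → Fin 2 → Globe n}
    (hy : ∀ k ≤ m, ∀ ε, memPos n k (y k ε)) (hy0 : y m 0 ≠ 0)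
    (hd : ∀ k < m, ∀ ε, DG n (y (k + 1) ε) = y k 1 - y k 0)
    (he : ∀ ε, augG n (y 0 ε) = 1) :
    (∀ k (hk : k < m), y k 0 = Finsupp.single (GlobeBasis.β ⟨k, by omega⟩) 1 ∧
      y k 1 = Finsupp.single (GlobeBasis.τ ⟨k, by omega⟩) 1) ∧
    (y m 0 = Finsupp.single (GlobeBasis.β ⟨m, hmn⟩) 1 ∨
      y m 0 = Finsupp.single (GlobeBasis.τ ⟨m, hmn⟩) 1) := by
  have coeffs : ∀ k ε, ∃ a c : ℤ, ∀ hk : k ≤ m, 0 ≤ a ∧ 0 ≤ c ∧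
      y k ε = Finsupp.single (GlobeBasis.β ⟨k, hk.trans_lt hmn⟩) a +
        Finsupp.single (GlobeBasis.τ ⟨k, hk.trans_lt hmn⟩) c := fun k ε => by
    by_cases hk : k ≤ m
    · obtain ⟨a, c, h⟩ := (hy k hk ε).eq_single_add_single (hk.trans_lt hmn)
      exact ⟨a, c, fun _ => h⟩
    · exact ⟨0, 0, fun h => absurd h hk⟩
  choose a c hac' using coeffs
  have hac := fun k hk ε => hac' k ε hk
  have step : ∀ k < m, ∀ ε, a (k + 1) ε + c (k + 1) ε = c k 1 - c k 0 ∧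
      a (k + 1) ε + c (k + 1) ε = a k 0 - a k 1 := fun k hk ε => by
    have h := hd k hk ε
    rw [(hac (k + 1) hk ε).2.2, DG_single_add_single, (hac k hk.le 0).2.2,
      (hac k hk.le 1).2.2] at h
    have hτ := DFunLike.congr_fun h (.τ ⟨k, by omega⟩)
    have hβ := DFunLike.congr_fun h (.β ⟨k, by omega⟩)
    simp at hτ hβ
    omega
  have sum_zero : ∀ ε, a 0 ε + c 0 ε = 1 := fun ε => by
    have h := he ε
    rw [(hac 0 (Nat.zero_le m) ε).2.2, augG, dif_pos (by omega)] at h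
    simpa using h
  have sum_pos : ∀ k ≤ m, 0 < a k 0 + c k 0 := fun k hk => by
    induction hk using Nat.decreasingInduction with
    | self =>
      obtain ⟨ha, hc, h⟩ := hac m le_rfl 0
      by_contra hs
      obtain ⟨ha0, hc0⟩ : a m 0 = 0 ∧ c m 0 = 0 := by omega
      exact hy0 (by simp [h, ha0, hc0])
    | of_succ k hk ih =>
      have := step k hk 0
      have := hac k hk.le 0
      have := hac k hk.le 1
      omega
  have sum_one : ∀ k ≤ m, ∀ ε, a k ε + c k ε = 1 := fun k => by
    induction k with
    | zero => exact fun _ => sum_zero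
    | succ k ih =>
      intro hk ε
      have := ih (by omega) 0
      have := ih (by omega) 1
      have := step k hk 0
      have := step k hk ε
      have := sum_pos (k + 1) hk
      have := hac k (by omega) 0
      have := hac k (by omega) 1
      omega
  refine ⟨fun k hk => ?_, ?_⟩
  · obtain ⟨ha₀, hc₀, h₀⟩ := hac k hk.le 0
    obtain ⟨ha₁, hc₁, h₁⟩ := hac k hk.le 1
    have := sum_one k hk.le 0
    have := sum_one k hk.le 1
    have := sum_one (k + 1) hk 0
    have := step k hk 0
    have e₁ : a k 0 = 1 := by omega
    have e₂ : c k 0 = 0 := by omega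
    have e₃ : a k 1 = 0 := by omega
    have e₄ : c k 1 = 1 := by omega
    simp [h₀, h₁, e₁, e₂, e₃, e₄]
  · obtain ⟨ha, hc, h⟩ := hac m le_rfl 0
    have := sum_one m le_rfl 0
    obtain ⟨e₁, e₂⟩ | ⟨e₁, e₂⟩ : a m 0 = 1 ∧ c m 0 = 0 ∨ a m 0 = 0 ∧ c m 0 = 1 := by omega
    · exact .inl (by simp [h, e₁, e₂])
    · exact .inr (by simp [h, e₁, e₂])

/-- **The two nondegenerate `m`-cells of the globe.**  Let `n ≥ 1` and `1 ≤ m < n`.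
Given `x_m ∈ G(n)_m*` nonzero and `x_k^ε ∈ G(n)_k*` for `0 ≤ k ≤ m-1`, `ε ∈ {0,1}`,
with `d(x_m) = x_{m-1}^1 - x_{m-1}^0`, `d(x_k^0) = d(x_k^1) = x_{k-1}^1 - x_{k-1}^0`
for `1 ≤ k ≤ m-1`, and `e(x_0^0) = e(x_0^1) = 1`, one has `x_m ∈ {β_m, τ_m}` and
`x_k^0 = β_k`, `x_k^1 = τ_k` for all `k ≤ m-1`.  (Hence `ν(λ(n̄))` has exactly two
nondegenerate `m`-cells for `0 < m < n`.) -/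
theorem globe_two_middle_cells (n : ℕ) (hn : 1 ≤ n) (m : ℕ) (hm1 : 1 ≤ m) (hmn : m < n)
    (xm : Globe n) (x : ℕ → Fin 2 → Globe n)
    (hxm : memPos n m xm) (hxm0 : xm ≠ 0)
    (hx : ∀ k ≤ m - 1, ∀ ε : Fin 2, memPos n k (x k ε))
    (hdtop : DG n xm = x (m - 1) 1 - x (m - 1) 0)
    (hd : ∀ k, 1 ≤ k → k ≤ m - 1 → ∀ ε : Fin 2,
        DG n (x k ε) = x (k - 1) 1 - x (k - 1) 0)
    (he : ∀ ε : Fin 2, augG n (x 0 ε) = 1) :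
    (xm = Finsupp.single (GlobeBasis.β ⟨m, hmn⟩) 1 ∨
     xm = Finsupp.single (GlobeBasis.τ ⟨m, hmn⟩) 1) ∧
    ∀ k (hk : k ≤ m - 1),
      x k 0 = Finsupp.single (GlobeBasis.β ⟨k, by omega⟩) 1 ∧
      x k 1 = Finsupp.single (GlobeBasis.τ ⟨k, by omega⟩) 1 := by
  have key := globe_cell_coeffs (m := m) hmn (y := fun k ε => if k < m then x k ε else xm)
    (fun k hk ε => by
      rcases hk.lt_or_eq with hk | rfl
      · simpa [hk] using hx k (by omega) ε
      · simpa using hxm)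
    (by simpa using hxm0)
    (fun k hk ε => by
      rcases (Nat.succ_le_of_lt hk).lt_or_eq with hk' | rfl
      · simpa [hk, hk'] using hd (k + 1) (by omega) (by omega) ε
      · simpa using hdtop)
    (fun ε => by simpa [Nat.lt_of_succ_le hm1] using he ε)
  refine ⟨by simpa using key.2, fun k hk => ?_⟩
  have hkm : k < m := by omega
  simpa [hkm] using key.1 k hkm
end

section
/- For every n ≥ 3, the inclusions exhibit T = I ⊗ G(n+1) as the colimit (in the category of chain complexes of abelian groups) of the zigzag L ←↩ L∩M ↪→ M ←↩ M∩R ↪→ R. Concretely: for every chain complex C of abelian groups and chain maps f_L : L → C, f_M : M → C, f_R : R → C such that f_L and f_M agree on L ∩ M and f_M and f_R agree on M ∩ R, there exists a unique chain map f : T → C whose restrictions to L, M, and R are f_L, f_M, and f_R respectively. (This is the chain-level gluing statement underlying the lax shuffle decomposition of the Gray cylinder over a globe.) -/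
/-- The basis of the tensor complex `T = I ⊗ G(n+1)` (interval tensor `(n+1)`-globe):
`hv = h⊗υ`, `lv = ℓ⊗υ`, `rv = r⊗υ`, `hb k = h⊗β_k`, `ht k = h⊗τ_k`,
`lb k = ℓ⊗β_k`, `lt' k = ℓ⊗τ_k`, `rb k = r⊗β_k`, `rt k = r⊗τ_k` for `0 ≤ k ≤ n`. -/
inductive TB (n : ℕ) : Type
  | hv : TB n
  | lv : TB n
  | rv : TB n
  | hb : Fin (n + 1) → TB n
  | ht : Fin (n + 1) → TB n
  | lb : Fin (n + 1) → TB n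
  | lt' : Fin (n + 1) → TB n
  | rb : Fin (n + 1) → TB n
  | rt : Fin (n + 1) → TB n
  deriving DecidableEq

/-- The underlying graded abelian group of `T = I ⊗ G(n+1)`: free abelian on `TB n`. -/
abbrev TT (n : ℕ) : Type := TB n →₀ ℤ

/-- The degree of a basis element of `T = I ⊗ G(n+1)`. -/
def degT (n : ℕ) : TB n → ℕ
  | .hv => n + 2
  | .lv => n + 1
  | .rv => n + 1
  | .hb k => (k : ℕ) + 1
  | .ht k => (k : ℕ) + 1
  | .lb k => k
  | .lt' k => k
  | .rb k => k
  | .rt k => k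

/-- The basis vector of `T` corresponding to a basis element. -/
noncomputable def eT {n : ℕ} (b : TB n) : TT n := Finsupp.single b 1

/-- The Koszul differential of `T = I ⊗ G(n+1)` on basis elements:
`d(x ⊗ y) = d(x) ⊗ y + (-1)^{deg x} x ⊗ d(y)`, with `d(h) = r - ℓ`,
`d(υ) = τ_n - β_n` and `d(β_k) = d(τ_k) = τ_{k-1} - β_{k-1}` (`0` for `k = 0`). -/
noncomputable def dTB (n : ℕ) : TB n → TT n
  | .hv => eT .rv - eT .lv - eT (.ht (Fin.last n)) + eT (.hb (Fin.last n))
  | .lv => eT (.lt' (Fin.last n)) - eT (.lb (Fin.last n))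
  | .rv => eT (.rt (Fin.last n)) - eT (.rb (Fin.last n))
  | .hb k => eT (.rb k) - eT (.lb k) -
      (if 0 < (k : ℕ) then
        eT (.ht ⟨(k : ℕ) - 1, lt_of_le_of_lt (Nat.sub_le _ _) k.isLt⟩)
          - eT (.hb ⟨(k : ℕ) - 1, lt_of_le_of_lt (Nat.sub_le _ _) k.isLt⟩)
      else 0)
  | .ht k => eT (.rt k) - eT (.lt' k) -
      (if 0 < (k : ℕ) then
        eT (.ht ⟨(k : ℕ) - 1, lt_of_le_of_lt (Nat.sub_le _ _) k.isLt⟩)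
          - eT (.hb ⟨(k : ℕ) - 1, lt_of_le_of_lt (Nat.sub_le _ _) k.isLt⟩)
      else 0)
  | .lb k =>
      if 0 < (k : ℕ) then
        eT (.lt' ⟨(k : ℕ) - 1, lt_of_le_of_lt (Nat.sub_le _ _) k.isLt⟩)
          - eT (.lb ⟨(k : ℕ) - 1, lt_of_le_of_lt (Nat.sub_le _ _) k.isLt⟩)
      else 0
  | .lt' k =>
      if 0 < (k : ℕ) then
        eT (.lt' ⟨(k : ℕ) - 1, lt_of_le_of_lt (Nat.sub_le _ _) k.isLt⟩)
          - eT (.lb ⟨(k : ℕ) - 1, lt_of_le_of_lt (Nat.sub_le _ _) k.isLt⟩)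
      else 0
  | .rb k =>
      if 0 < (k : ℕ) then
        eT (.rt ⟨(k : ℕ) - 1, lt_of_le_of_lt (Nat.sub_le _ _) k.isLt⟩)
          - eT (.rb ⟨(k : ℕ) - 1, lt_of_le_of_lt (Nat.sub_le _ _) k.isLt⟩)
      else 0
  | .rt k =>
      if 0 < (k : ℕ) then
        eT (.rt ⟨(k : ℕ) - 1, lt_of_le_of_lt (Nat.sub_le _ _) k.isLt⟩)
          - eT (.rb ⟨(k : ℕ) - 1, lt_of_le_of_lt (Nat.sub_le _ _) k.isLt⟩)
      else 0

/-- The differential of `T = I ⊗ G(n+1)` as a `ℤ`-linear endomorphism. -/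
noncomputable def DT (n : ℕ) : TT n →ₗ[ℤ] TT n :=
  Finsupp.linearCombination ℤ (dTB n)

/-- Degree-`m` generators of the subcomplex `L` (the image of `λ([2];(n̄,[0]))`). -/
def LGen (n : ℕ) : ℕ → Set (TT n)
  | 0 => {eT (.lb 0), eT (.lt' 0), eT (.rt 0)}
  | 1 => {eT (.lb 1), eT (.lt' 1), eT (.ht 0)}
  | m + 2 =>
      if h : m + 2 ≤ n then {eT (.lb ⟨m + 2, by omega⟩), eT (.lt' ⟨m + 2, by omega⟩)}
      else if m + 2 = n + 1 then {eT .lv}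
      else ∅

/-- Degree-`m` generators of the subcomplex `R` (the image of `λ([2];([0],n̄))`). -/
def RGen (n : ℕ) : ℕ → Set (TT n)
  | 0 => {eT (.lb 0), eT (.rb 0), eT (.rt 0)}
  | 1 => {eT (.rb 1), eT (.rt 1), eT (.hb 0)}
  | m + 2 =>
      if h : m + 2 ≤ n then {eT (.rb ⟨m + 2, by omega⟩), eT (.rt ⟨m + 2, by omega⟩)}
      else if m + 2 = n + 1 then {eT .rv}
      else ∅

/-- Degree-`m` generators of the subcomplex `M` (the image of `λ([1];([1]⊗n̄))`). -/
def MGen (n : ℕ) : ℕ → Set (TT n)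
  | 0 => {eT (.lb 0), eT (.rt 0)}
  | 1 => {eT (.lb 1) + eT (.ht 0), eT (.lt' 1) + eT (.ht 0),
          eT (.hb 0) + eT (.rb 1), eT (.hb 0) + eT (.rt 1)}
  | m + 2 =>
      if h : m + 2 ≤ n then
        {eT (.lb ⟨m + 2, by omega⟩), eT (.lt' ⟨m + 2, by omega⟩),
         eT (.rb ⟨m + 2, by omega⟩), eT (.rt ⟨m + 2, by omega⟩),
         eT (.hb ⟨m + 1, by omega⟩), eT (.ht ⟨m + 1, by omega⟩)}
      else if m + 2 = n + 1 then {eT .lv, eT .rv, eT (.hb (Fin.last n)), eT (.ht (Fin.last n))}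
      else if m + 2 = n + 2 then {eT .hv}
      else ∅

/-- All generators of `L`. -/
def LSet (n : ℕ) : Set (TT n) := ⋃ m, LGen n m

/-- All generators of `M`. -/
def MSet (n : ℕ) : Set (TT n) := ⋃ m, MGen n m

/-- All generators of `R`. -/
def RSet (n : ℕ) : Set (TT n) := ⋃ m, RGen n m

/-- The graded subgroup `L` of `T`. -/
noncomputable def Lsub (n : ℕ) : Submodule ℤ (TT n) := Submodule.span ℤ (LSet n)

/-- The graded subgroup `M` of `T`. -/
noncomputable def Msub (n : ℕ) : Submodule ℤ (TT n) := Submodule.span ℤ (MSet n)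

/-- The graded subgroup `R` of `T`. -/
noncomputable def Rsub (n : ℕ) : Submodule ℤ (TT n) := Submodule.span ℤ (RSet n)

/-- The degree-`m` graded piece `T_m` of `T`, spanned by the degree-`m` basis elements. -/
noncomputable def Tdeg (n m : ℕ) : Submodule ℤ (TT n) :=
  Submodule.span ℤ {x : TT n | ∃ b : TB n, degT n b = m ∧ x = eT b}

lemma linearCombination_single_one {R M α : Type*} [Semiring R] [AddCommMonoid M] [Module R M]
    (v : α → M) (a : α) : Finsupp.linearCombination R v (Finsupp.single a 1) = v a := by
  simp

lemma DT_eT {n : ℕ} (b : TB n) : DT n (eT b) = dTB n b := by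
  simp [DT, eT]

lemma eT_mem_Tdeg {n m : ℕ} {b : TB n} (h : degT n b = m) : eT b ∈ Tdeg n m :=
  Submodule.subset_span ⟨b, h, rfl⟩

lemma val_one_fin {n : ℕ} (hn : 1 ≤ n) : ((1 : Fin (n + 1)) : ℕ) = 1 := by
  rw [Fin.val_one', Nat.mod_eq_of_lt (by omega)]

/-- The projection of `T` onto its degree-`m` part. -/
noncomputable def degProj (n m : ℕ) : TT n →ₗ[ℤ] TT n :=
  Finsupp.linearCombination ℤ fun b => if degT n b = m then eT b else 0

lemma degProj_eT {n : ℕ} (m : ℕ) (b : TB n) :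
    degProj n m (eT b) = if degT n b = m then eT b else 0 := by
  simp [degProj, eT]

lemma degProj_of_mem {n m k : ℕ} {x : TT n} (hx : x ∈ Tdeg n k) :
    degProj n m x = if k = m then x else 0 := by
  induction hx using Submodule.span_induction with
  | mem x h =>
    obtain ⟨b, rfl, rfl⟩ := h
    exact degProj_eT m b
  | zero => simp
  | add x y _ _ hx hy => rw [map_add, hx, hy]; split_ifs <;> simp
  | smul a x _ hx => rw [map_smul, hx]; split_ifs <;> simp

/-- The degree-`m` part of a subgroup with homogeneous generators is spanned by the
generators of degree `m`. -/
lemma span_iUnion_inf_Tdeg_le {n : ℕ} {G : ℕ → Set (TT n)}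
    (hG : ∀ k, ∀ x ∈ G k, x ∈ Tdeg n k) (m : ℕ) :
    Submodule.span ℤ (⋃ k, G k) ⊓ Tdeg n m ≤ Submodule.span ℤ (G m) := by
  rintro x ⟨hx, hxm⟩
  have key : Submodule.span ℤ (⋃ k, G k) ≤ (Submodule.span ℤ (G m)).comap (degProj n m) := by
    rw [Submodule.span_le]
    intro y hy
    obtain ⟨k, hk⟩ := Set.mem_iUnion.mp hy
    simp only [SetLike.mem_coe, Submodule.mem_comap, degProj_of_mem (hG k y hk)]
    split_ifs with h
    · exact Submodule.subset_span (h ▸ hk)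
    · exact Submodule.zero_mem _
  have := key hx
  rwa [Submodule.mem_comap, degProj_of_mem hxm, if_pos rfl] at this

lemma LGen_subset_Tdeg {n : ℕ} (hn : 1 ≤ n) (m : ℕ) : ∀ x ∈ LGen n m, x ∈ Tdeg n m := by
  intro x hx
  match m with
  | 0 =>
    simp only [LGen, Set.mem_insert_iff, Set.mem_singleton_iff] at hx
    rcases hx with rfl | rfl | rfl <;> exact eT_mem_Tdeg (by simp [degT])
  | 1 =>
    simp only [LGen, Set.mem_insert_iff, Set.mem_singleton_iff] at hx
    rcases hx with rfl | rfl | rfl <;> exact eT_mem_Tdeg (by simp [degT] <;> omega)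
  | m + 2 =>
    simp only [LGen] at hx
    split_ifs at hx with h h'
    · rcases hx with rfl | rfl <;> exact eT_mem_Tdeg rfl
    · obtain rfl := hx
      exact eT_mem_Tdeg h'.symm
    · exact hx.elim

lemma RGen_subset_Tdeg {n : ℕ} (hn : 1 ≤ n) (m : ℕ) : ∀ x ∈ RGen n m, x ∈ Tdeg n m := by
  intro x hx
  match m with
  | 0 =>
    simp only [RGen, Set.mem_insert_iff, Set.mem_singleton_iff] at hx
    rcases hx with rfl | rfl | rfl <;> exact eT_mem_Tdeg (by simp [degT])
  | 1 =>
    simp only [RGen, Set.mem_insert_iff, Set.mem_singleton_iff] at hx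
    rcases hx with rfl | rfl | rfl <;> exact eT_mem_Tdeg (by simp [degT] <;> omega)
  | m + 2 =>
    simp only [RGen] at hx
    split_ifs at hx with h h'
    · rcases hx with rfl | rfl <;> exact eT_mem_Tdeg rfl
    · obtain rfl := hx
      exact eT_mem_Tdeg h'.symm
    · exact hx.elim

lemma MGen_subset_Tdeg {n : ℕ} (hn : 1 ≤ n) (m : ℕ) : ∀ x ∈ MGen n m, x ∈ Tdeg n m := by
  intro x hx
  match m with
  | 0 =>
    simp only [MGen, Set.mem_insert_iff, Set.mem_singleton_iff] at hx
    rcases hx with rfl | rfl <;> exact eT_mem_Tdeg (by simp [degT])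
  | 1 =>
    simp only [MGen, Set.mem_insert_iff, Set.mem_singleton_iff] at hx
    rcases hx with rfl | rfl | rfl | rfl <;>
      exact add_mem (eT_mem_Tdeg (by simp [degT] <;> omega))
        (eT_mem_Tdeg (by simp [degT] <;> omega))
  | m + 2 =>
    simp only [MGen] at hx
    split_ifs at hx with h h' h''
    · rcases hx with rfl | rfl | rfl | rfl | rfl | rfl <;> exact eT_mem_Tdeg rfl
    · rcases hx with rfl | rfl | rfl | rfl <;> exact eT_mem_Tdeg (by simp [degT]; omega)
    · obtain rfl := hx
      exact eT_mem_Tdeg h''.symm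
    · exact hx.elim

lemma mem_Lsub_of_mem_LGen {n : ℕ} (m : ℕ) {x : TT n} (h : x ∈ LGen n m) : x ∈ Lsub n :=
  Submodule.subset_span (Set.mem_iUnion.mpr ⟨m, h⟩)

lemma mem_Rsub_of_mem_RGen {n : ℕ} (m : ℕ) {x : TT n} (h : x ∈ RGen n m) : x ∈ Rsub n :=
  Submodule.subset_span (Set.mem_iUnion.mpr ⟨m, h⟩)

lemma mem_Msub_of_mem_MGen {n : ℕ} (m : ℕ) {x : TT n} (h : x ∈ MGen n m) : x ∈ Msub n :=
  Submodule.subset_span (Set.mem_iUnion.mpr ⟨m, h⟩)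

/-- A position in a globe is `0`, `1`, or at least `2`. -/
lemma fin_zero_one_or_two_le {n : ℕ} (hn : 1 ≤ n) (k : Fin (n + 1)) :
    k = 0 ∨ k = 1 ∨ ∃ m, ∃ h : m + 2 ≤ n, k = ⟨m + 2, by omega⟩ := by
  have h1 := val_one_fin hn
  obtain ⟨k, hk⟩ := k
  match k with
  | 0 => exact Or.inl rfl
  | 1 => exact Or.inr (Or.inl (Fin.ext h1.symm))
  | m + 2 => exact Or.inr (Or.inr ⟨m, by omega, rfl⟩)

section Membership

variable {n : ℕ}

lemma lb_mem_Lsub (hn : 1 ≤ n) (k : Fin (n + 1)) : eT (.lb k) ∈ Lsub n := by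
  rcases fin_zero_one_or_two_le hn k with rfl | rfl | ⟨m, h, rfl⟩
  · exact mem_Lsub_of_mem_LGen 0 (by simp [LGen])
  · exact mem_Lsub_of_mem_LGen 1 (by simp [LGen])
  · exact mem_Lsub_of_mem_LGen (m + 2) (by simp [LGen, h])

lemma lt'_mem_Lsub (hn : 1 ≤ n) (k : Fin (n + 1)) : eT (.lt' k) ∈ Lsub n := by
  rcases fin_zero_one_or_two_le hn k with rfl | rfl | ⟨m, h, rfl⟩
  · exact mem_Lsub_of_mem_LGen 0 (by simp [LGen])
  · exact mem_Lsub_of_mem_LGen 1 (by simp [LGen])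
  · exact mem_Lsub_of_mem_LGen (m + 2) (by simp [LGen, h])

lemma ht_zero_mem_Lsub : eT (.ht 0) ∈ Lsub n := mem_Lsub_of_mem_LGen 1 (by simp [LGen])

lemma rt_zero_mem_Lsub : eT (.rt 0) ∈ Lsub n := mem_Lsub_of_mem_LGen 0 (by simp [LGen])

lemma lv_mem_Lsub (hn : 1 ≤ n) : eT .lv ∈ Lsub n := by
  obtain ⟨k, rfl⟩ := Nat.exists_eq_add_of_le' hn
  exact mem_Lsub_of_mem_LGen (k + 2) (by simp [LGen])

lemma rb_mem_Rsub (hn : 1 ≤ n) (k : Fin (n + 1)) : eT (.rb k) ∈ Rsub n := by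
  rcases fin_zero_one_or_two_le hn k with rfl | rfl | ⟨m, h, rfl⟩
  · exact mem_Rsub_of_mem_RGen 0 (by simp [RGen])
  · exact mem_Rsub_of_mem_RGen 1 (by simp [RGen])
  · exact mem_Rsub_of_mem_RGen (m + 2) (by simp [RGen, h])

lemma rt_mem_Rsub (hn : 1 ≤ n) (k : Fin (n + 1)) : eT (.rt k) ∈ Rsub n := by
  rcases fin_zero_one_or_two_le hn k with rfl | rfl | ⟨m, h, rfl⟩
  · exact mem_Rsub_of_mem_RGen 0 (by simp [RGen])
  · exact mem_Rsub_of_mem_RGen 1 (by simp [RGen])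
  · exact mem_Rsub_of_mem_RGen (m + 2) (by simp [RGen, h])

lemma hb_zero_mem_Rsub : eT (.hb 0) ∈ Rsub n := mem_Rsub_of_mem_RGen 1 (by simp [RGen])

lemma lb_zero_mem_Rsub : eT (.lb 0) ∈ Rsub n := mem_Rsub_of_mem_RGen 0 (by simp [RGen])

lemma rv_mem_Rsub (hn : 1 ≤ n) : eT .rv ∈ Rsub n := by
  obtain ⟨k, rfl⟩ := Nat.exists_eq_add_of_le' hn
  exact mem_Rsub_of_mem_RGen (k + 2) (by simp [RGen])

/-- In degrees at least `2`, every basis element of `T` lies in `M`. -/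
lemma mem_Msub_of_two_le_degT (hn : 1 ≤ n) (b : TB n) (hb : 2 ≤ degT n b) :
    eT b ∈ Msub n := by
  apply mem_Msub_of_mem_MGen (degT n b)
  obtain ⟨m, hm⟩ := Nat.exists_eq_add_of_le' hb
  rw [hm]
  have last_of {k : Fin (n + 1)} (h1 : (k : ℕ) = m + 1) (h2 : ¬ m + 2 ≤ n) : k = Fin.last n :=
    Fin.ext (by have := k.isLt; simp only [Fin.val_last]; omega)
  cases b with
  | hv =>
    obtain rfl : m = n := by simp only [degT] at hm; omega
    simp [MGen]
  | lv =>
    obtain rfl : n = m + 1 := by simp only [degT] at hm; omega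
    simp [MGen]
  | rv =>
    obtain rfl : n = m + 1 := by simp only [degT] at hm; omega
    simp [MGen]
  | hb k =>
    have hk : (k : ℕ) = m + 1 := by simp only [degT] at hm; omega
    by_cases h : m + 2 ≤ n
    · rw [show k = ⟨m + 1, by omega⟩ from Fin.ext hk]
      simp [MGen, h]
    · obtain rfl := last_of hk h
      obtain rfl : n = m + 1 := hk
      simp [MGen]
  | ht k =>
    have hk : (k : ℕ) = m + 1 := by simp only [degT] at hm; omega
    by_cases h : m + 2 ≤ n
    · rw [show k = ⟨m + 1, by omega⟩ from Fin.ext hk]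
      simp [MGen, h]
    · obtain rfl := last_of hk h
      obtain rfl : n = m + 1 := hk
      simp [MGen]
  | lb k | lt' k | rb k | rt k =>
    have h : m + 2 ≤ n := by have := k.isLt; simp only [degT] at hm; omega
    rw [show k = ⟨m + 2, by omega⟩ from Fin.ext hm]
    simp [MGen, h]

lemma lb_zero_mem_Msub : eT (.lb 0) ∈ Msub n := mem_Msub_of_mem_MGen 0 (by simp [MGen])

lemma rt_zero_mem_Msub : eT (.rt 0) ∈ Msub n := mem_Msub_of_mem_MGen 0 (by simp [MGen])

lemma dTB_mem_Msub_of_pos (hn : 1 ≤ n) {k : Fin (n + 1)} (hk : 0 < (k : ℕ)) :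
    dTB n (.hb k) ∈ Msub n ∧ dTB n (.ht k) ∈ Msub n := by
  simp only [dTB, if_pos hk]
  rcases fin_zero_one_or_two_le hn k with rfl | rfl | ⟨m, h, rfl⟩
  · simp at hk
  · have h0 : (⟨((1 : Fin (n + 1)) : ℕ) - 1, lt_of_le_of_lt (Nat.sub_le _ _) (Fin.isLt _)⟩ :
        Fin (n + 1)) = 0 := Fin.ext (show ((1 : Fin (n + 1)) : ℕ) - 1 = 0 by rw [val_one_fin hn])
    rw [h0]
    have a1 : eT (.lb 1) + eT (.ht 0) ∈ Msub n := mem_Msub_of_mem_MGen 1 (by simp [MGen])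
    have a2 : eT (.lt' 1) + eT (.ht 0) ∈ Msub n := mem_Msub_of_mem_MGen 1 (by simp [MGen])
    have a3 : eT (.hb 0) + eT (.rb 1) ∈ Msub n := mem_Msub_of_mem_MGen 1 (by simp [MGen])
    have a4 : eT (.hb 0) + eT (.rt 1) ∈ Msub n := mem_Msub_of_mem_MGen 1 (by simp [MGen])
    constructor
    · convert sub_mem a3 a1 using 1
      abel
    · convert sub_mem a4 a2 using 1
      abel
  · constructor <;>
      refine sub_mem (sub_mem ?_ ?_) (sub_mem ?_ ?_) <;>
      exact mem_Msub_of_two_le_degT hn _ (by simp [degT])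

/-- Every basis element of `T` lies, together with its differential, in `L`, `M` or `R`. -/
lemma eT_mem_piece (hn : 1 ≤ n) (b : TB n) :
    (eT b ∈ Lsub n ∧ dTB n b ∈ Lsub n) ∨ (eT b ∈ Msub n ∧ dTB n b ∈ Msub n) ∨
      (eT b ∈ Rsub n ∧ dTB n b ∈ Rsub n) := by
  have hl (p : Prop) [Decidable p] (j k : Fin (n + 1)) :
      (if p then eT (.lt' j) - eT (.lb k) else 0 : TT n) ∈ Lsub n := by
    split_ifs
    · exact sub_mem (lt'_mem_Lsub hn _) (lb_mem_Lsub hn _)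
    · exact zero_mem _
  have hr (p : Prop) [Decidable p] (j k : Fin (n + 1)) :
      (if p then eT (.rt j) - eT (.rb k) else 0 : TT n) ∈ Rsub n := by
    split_ifs
    · exact sub_mem (rt_mem_Rsub hn _) (rb_mem_Rsub hn _)
    · exact zero_mem _
  cases b with
  | hv =>
    refine Or.inr (Or.inl ⟨mem_Msub_of_two_le_degT hn _ (by simp [degT]), ?_⟩)
    refine add_mem (sub_mem (sub_mem ?_ ?_) ?_) ?_ <;>
      exact mem_Msub_of_two_le_degT hn _ (by simp [degT]; omega)
  | lv => exact Or.inl ⟨lv_mem_Lsub hn, sub_mem (lt'_mem_Lsub hn _) (lb_mem_Lsub hn _)⟩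
  | rv => exact Or.inr (Or.inr ⟨rv_mem_Rsub hn, sub_mem (rt_mem_Rsub hn _) (rb_mem_Rsub hn _)⟩)
  | hb k =>
    rcases Nat.eq_zero_or_pos (k : ℕ) with h | h
    · obtain rfl : k = 0 := Fin.ext h
      refine Or.inr (Or.inr ⟨hb_zero_mem_Rsub, ?_⟩)
      simpa [dTB] using sub_mem (rb_mem_Rsub hn 0) lb_zero_mem_Rsub
    · exact Or.inr (Or.inl ⟨mem_Msub_of_two_le_degT hn _ (by simp only [degT]; omega),
        (dTB_mem_Msub_of_pos hn h).1⟩)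
  | ht k =>
    rcases Nat.eq_zero_or_pos (k : ℕ) with h | h
    · obtain rfl : k = 0 := Fin.ext h
      refine Or.inl ⟨ht_zero_mem_Lsub, ?_⟩
      simpa [dTB] using sub_mem rt_zero_mem_Lsub (lt'_mem_Lsub hn 0)
    · exact Or.inr (Or.inl ⟨mem_Msub_of_two_le_degT hn _ (by simp only [degT]; omega),
        (dTB_mem_Msub_of_pos hn h).2⟩)
  | lb k => exact Or.inl ⟨lb_mem_Lsub hn k, hl _ _ _⟩
  | lt' k => exact Or.inl ⟨lt'_mem_Lsub hn k, hl _ _ _⟩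
  | rb k => exact Or.inr (Or.inr ⟨rb_mem_Rsub hn k, hr _ _ _⟩)
  | rt k => exact Or.inr (Or.inr ⟨rt_mem_Rsub hn k, hr _ _ _⟩)

/-- The differential of `T` lowers the degree by one. -/
lemma dTB_mem_Tdeg {m : ℕ} {b : TB n} (hb : degT n b = m + 1) : dTB n b ∈ Tdeg n m := by
  have h0 (k : Fin (n + 1)) (u v : Fin (n + 1) → TB n)
      (hu : ∀ j, degT n (u j) = degT n (u 0) + j) (hv : ∀ j, degT n (v j) = degT n (u 0) + j)
      (hk : 0 < (k : ℕ) → degT n (u 0) + k = m + 1) :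
      (if 0 < (k : ℕ) then
        eT (u ⟨(k : ℕ) - 1, lt_of_le_of_lt (Nat.sub_le _ _) k.isLt⟩)
          - eT (v ⟨(k : ℕ) - 1, lt_of_le_of_lt (Nat.sub_le _ _) k.isLt⟩)
      else 0) ∈ Tdeg n m := by
    split_ifs with h
    · have := hk h
      exact sub_mem (eT_mem_Tdeg (by rw [hu]; simp only; omega))
        (eT_mem_Tdeg (by rw [hv]; simp only; omega))
    · exact zero_mem _
  cases b with
  | hv =>
    refine add_mem (sub_mem (sub_mem ?_ ?_) ?_) ?_ <;>
      exact eT_mem_Tdeg (by simp [degT] at hb ⊢; omega)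
  | lv | rv => refine sub_mem ?_ ?_ <;> exact eT_mem_Tdeg (by simp [degT] at hb ⊢; omega)
  | hb k | ht k =>
    refine sub_mem (sub_mem ?_ ?_) (h0 k .ht .hb ?_ ?_ ?_)
    · exact eT_mem_Tdeg (by simp [degT] at hb ⊢; omega)
    · exact eT_mem_Tdeg (by simp [degT] at hb ⊢; omega)
    all_goals simp [degT] at hb ⊢; omega
  | lb k | lt' k =>
    exact h0 k .lt' .lb (by simp [degT]) (by simp [degT])
      (by simpa [degT] using fun _ => hb)
  | rb k | rt k =>
    exact h0 k .rt .rb (by simp [degT]) (by simp [degT])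
      (by simpa [degT] using fun _ => hb)

end Membership

section Gluing

variable {n : ℕ} {A : Type*} [AddCommGroup A] [Module ℤ A]

open Classical in
/-- The extension by zero, as a mere function, of a homomorphism defined on a subgroup of `T`. -/
noncomputable def extendByZero {S : Submodule ℤ (TT n)} (φ : S →ₗ[ℤ] A) (x : TT n) : A :=
  if h : x ∈ S then φ ⟨x, h⟩ else 0

lemma extendByZero_of_mem {S : Submodule ℤ (TT n)} (φ : S →ₗ[ℤ] A) {x : TT n} (h : x ∈ S) :
    extendByZero φ x = φ ⟨x, h⟩ :=
  dif_pos h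

lemma eq_of_eqOn_generators {S : Submodule ℤ (TT n)} (φ : S →ₗ[ℤ] A) (Φ : TT n →ₗ[ℤ] A)
    {G : Set (TT n)} (hGS : G ⊆ S) (hSG : S ≤ Submodule.span ℤ G)
    (h : ∀ x ∈ G, Φ x = extendByZero φ x) (x : TT n) (hx : x ∈ S) : Φ x = φ ⟨x, hx⟩ := by
  have hle : Submodule.span ℤ G ≤ S := Submodule.span_le.mpr hGS
  suffices ∀ y ∈ Submodule.span ℤ G, ∀ hy : y ∈ S, Φ y = φ ⟨y, hy⟩ from this x (hSG hx) hx
  intro y hy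
  induction hy using Submodule.span_induction with
  | mem y hy => exact fun hyS => (h y hy).trans (extendByZero_of_mem φ hyS)
  | zero => exact fun _ => (map_zero Φ).trans (map_zero φ).symm
  | add y z hy hz ihy ihz =>
    intro _
    rw [map_add, ihy (hle hy), ihz (hle hz), ← map_add]
    rfl
  | smul a y hy ihy =>
    intro _
    rw [Φ.map_smul, ihy (hle hy), ← φ.map_smul]
    rfl

/-- The glued map on basis elements, from functions to be used on `L`, `M` and `R`. -/
noncomputable def glueBasis (FL FM FR : TT n → A) : TB n → A
  | .hv => FM (eT .hv)
  | .lv => FL (eT .lv)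
  | .rv => FR (eT .rv)
  | .hb k => if k = 0 then FR (eT (.hb k)) else FM (eT (.hb k))
  | .ht k => if k = 0 then FL (eT (.ht k)) else FM (eT (.ht k))
  | .lb k => FL (eT (.lb k))
  | .lt' k => FL (eT (.lt' k))
  | .rb k => FR (eT (.rb k))
  | .rt k => if k = 0 then FL (eT (.rt k)) else FR (eT (.rt k))

/-- The linear extension of `glueBasis` to `T`. -/
noncomputable def glue (FL FM FR : TT n → A) : TT n →ₗ[ℤ] A :=
  Finsupp.linearCombination ℤ (glueBasis FL FM FR)

lemma glue_eT (FL FM FR : TT n → A) (b : TB n) :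
    glue FL FM FR (eT b) = glueBasis FL FM FR b :=
  linearCombination_single_one _ b

lemma glue_eq_on_LGen (FL FM FR : TT n → A) (m : ℕ) (x : TT n) (hx : x ∈ LGen n m) :
    glue FL FM FR x = FL x := by
  match m with
  | 0 | 1 =>
    simp only [LGen, Set.mem_insert_iff, Set.mem_singleton_iff] at hx
    rcases hx with rfl | rfl | rfl <;> simp [glue_eT, glueBasis]
  | m + 2 =>
    simp only [LGen] at hx
    split_ifs at hx
    · rcases hx with rfl | rfl <;> simp [glue_eT, glueBasis]
    · obtain rfl := hx
      simp [glue_eT, glueBasis]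
    · exact hx.elim

variable {m : ℕ} (φL : ↥(Lsub n ⊓ Tdeg n m) →ₗ[ℤ] A) (φM : ↥(Msub n ⊓ Tdeg n m) →ₗ[ℤ] A)
  (φR : ↥(Rsub n ⊓ Tdeg n m) →ₗ[ℤ] A)

lemma glue_eq_on_Lsub (hn : 1 ≤ n) (FM FR : TT n → A) (x : TT n)
    (hx : x ∈ Lsub n ⊓ Tdeg n m) :
    glue (extendByZero φL) FM FR x = φL ⟨x, hx⟩ :=
  eq_of_eqOn_generators φL _
    (fun y hy => Submodule.mem_inf.mpr ⟨mem_Lsub_of_mem_LGen m hy, LGen_subset_Tdeg hn m y hy⟩)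
    (span_iUnion_inf_Tdeg_le (LGen_subset_Tdeg hn) m) (glue_eq_on_LGen _ _ _ m) x hx

lemma extendByZero_L_eq_M
    (hLM : ∀ x (h1 : x ∈ Lsub n ⊓ Tdeg n m) (h2 : x ∈ Msub n ⊓ Tdeg n m),
      φL ⟨x, h1⟩ = φM ⟨x, h2⟩)
    {x : TT n} (h1 : x ∈ Lsub n) (h2 : x ∈ Msub n) (h : x ∈ Tdeg n m) :
    extendByZero φL x = extendByZero φM x := by
  rw [extendByZero_of_mem φL (Submodule.mem_inf.mpr ⟨h1, h⟩),
    extendByZero_of_mem φM (Submodule.mem_inf.mpr ⟨h2, h⟩), hLM]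

lemma extendByZero_R_eq_M
    (hMR : ∀ x (h1 : x ∈ Msub n ⊓ Tdeg n m) (h2 : x ∈ Rsub n ⊓ Tdeg n m),
      φM ⟨x, h1⟩ = φR ⟨x, h2⟩)
    {x : TT n} (h1 : x ∈ Rsub n) (h2 : x ∈ Msub n) (h : x ∈ Tdeg n m) :
    extendByZero φR x = extendByZero φM x := by
  rw [extendByZero_of_mem φR (Submodule.mem_inf.mpr ⟨h1, h⟩),
    extendByZero_of_mem φM (Submodule.mem_inf.mpr ⟨h2, h⟩), hMR]

lemma glue_eq_on_Rsub
    (hLM : ∀ x (h1 : x ∈ Lsub n ⊓ Tdeg n m) (h2 : x ∈ Msub n ⊓ Tdeg n m),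
      φL ⟨x, h1⟩ = φM ⟨x, h2⟩)
    (hMR : ∀ x (h1 : x ∈ Msub n ⊓ Tdeg n m) (h2 : x ∈ Rsub n ⊓ Tdeg n m),
      φM ⟨x, h1⟩ = φR ⟨x, h2⟩)
    (hn : 1 ≤ n) (x : TT n) (hx : x ∈ Rsub n ⊓ Tdeg n m) :
    glue (extendByZero φL) (extendByZero φM) (extendByZero φR) x = φR ⟨x, hx⟩ := by
  refine eq_of_eqOn_generators φR _
    (fun y hy => Submodule.mem_inf.mpr ⟨mem_Rsub_of_mem_RGen m hy, RGen_subset_Tdeg hn m y hy⟩)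
    (span_iUnion_inf_Tdeg_le (RGen_subset_Tdeg hn) m) ?_ x hx
  intro y hy
  have hyd := RGen_subset_Tdeg hn m y hy
  match m with
  | 0 =>
    simp only [RGen, Set.mem_insert_iff, Set.mem_singleton_iff] at hy
    rcases hy with rfl | rfl | rfl
    · rw [glue_eT, glueBasis,
        extendByZero_L_eq_M φL φM hLM (lb_mem_Lsub hn 0) lb_zero_mem_Msub hyd,
        extendByZero_R_eq_M φM φR hMR lb_zero_mem_Rsub lb_zero_mem_Msub hyd]
    · simp [glue_eT, glueBasis]
    · rw [glue_eT, glueBasis, if_pos rfl,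
        extendByZero_L_eq_M φL φM hLM rt_zero_mem_Lsub rt_zero_mem_Msub hyd,
        extendByZero_R_eq_M φM φR hMR (rt_mem_Rsub hn 0) rt_zero_mem_Msub hyd]
  | 1 =>
    simp only [RGen, Set.mem_insert_iff, Set.mem_singleton_iff] at hy
    rcases hy with rfl | rfl | rfl
    · simp [glue_eT, glueBasis]
    · have h1 : (1 : Fin (n + 1)) ≠ 0 := by simp [Fin.ext_iff]; omega
      rw [glue_eT, glueBasis, if_neg h1]
    · simp [glue_eT, glueBasis]
  | k + 2 =>
    simp only [RGen] at hy
    split_ifs at hy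
    · rcases hy with rfl | rfl <;> simp [glue_eT, glueBasis]
    · obtain rfl := hy
      simp [glue_eT, glueBasis]
    · exact hy.elim

lemma glue_eq_on_Msub
    (hLM : ∀ x (h1 : x ∈ Lsub n ⊓ Tdeg n m) (h2 : x ∈ Msub n ⊓ Tdeg n m),
      φL ⟨x, h1⟩ = φM ⟨x, h2⟩)
    (hMR : ∀ x (h1 : x ∈ Msub n ⊓ Tdeg n m) (h2 : x ∈ Rsub n ⊓ Tdeg n m),
      φM ⟨x, h1⟩ = φR ⟨x, h2⟩)
    (hn : 1 ≤ n) (x : TT n) (hx : x ∈ Msub n ⊓ Tdeg n m) :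
    glue (extendByZero φL) (extendByZero φM) (extendByZero φR) x = φM ⟨x, hx⟩ := by
  refine eq_of_eqOn_generators φM _
    (fun y hy => Submodule.mem_inf.mpr ⟨mem_Msub_of_mem_MGen m hy, MGen_subset_Tdeg hn m y hy⟩)
    (span_iUnion_inf_Tdeg_le (MGen_subset_Tdeg hn) m) ?_ x hx
  intro y hy
  have hyM := mem_Msub_of_mem_MGen m hy
  have hyd := MGen_subset_Tdeg hn m y hy
  have of_L (h : y ∈ Lsub n) :
      glue (extendByZero φL) (extendByZero φM) (extendByZero φR) y = extendByZero φM y := by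
    rw [glue_eq_on_Lsub φL hn _ _ y (Submodule.mem_inf.mpr ⟨h, hyd⟩),
      hLM y (Submodule.mem_inf.mpr ⟨h, hyd⟩) (Submodule.mem_inf.mpr ⟨hyM, hyd⟩),
      extendByZero_of_mem φM (Submodule.mem_inf.mpr ⟨hyM, hyd⟩)]
  have of_R (h : y ∈ Rsub n) :
      glue (extendByZero φL) (extendByZero φM) (extendByZero φR) y = extendByZero φM y := by
    rw [glue_eq_on_Rsub φL φM φR hLM hMR hn y (Submodule.mem_inf.mpr ⟨h, hyd⟩),
      ← hMR y (Submodule.mem_inf.mpr ⟨hyM, hyd⟩) (Submodule.mem_inf.mpr ⟨h, hyd⟩),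
      extendByZero_of_mem φM (Submodule.mem_inf.mpr ⟨hyM, hyd⟩)]
  match m with
  | 0 =>
    simp only [MGen, Set.mem_insert_iff, Set.mem_singleton_iff] at hy
    rcases hy with rfl | rfl
    · exact of_L (lb_mem_Lsub hn 0)
    · exact of_L rt_zero_mem_Lsub
  | 1 =>
    simp only [MGen, Set.mem_insert_iff, Set.mem_singleton_iff] at hy
    rcases hy with rfl | rfl | rfl | rfl
    · exact of_L (add_mem (lb_mem_Lsub hn 1) ht_zero_mem_Lsub)
    · exact of_L (add_mem (lt'_mem_Lsub hn 1) ht_zero_mem_Lsub)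
    · exact of_R (add_mem hb_zero_mem_Rsub (rb_mem_Rsub hn 1))
    · exact of_R (add_mem hb_zero_mem_Rsub (rt_mem_Rsub hn 1))
  | k + 2 =>
    simp only [MGen] at hy
    split_ifs at hy
    · rcases hy with rfl | rfl | rfl | rfl | rfl | rfl
      · exact of_L (lb_mem_Lsub hn _)
      · exact of_L (lt'_mem_Lsub hn _)
      · exact of_R (rb_mem_Rsub hn _)
      · exact of_R (rt_mem_Rsub hn _)
      · simp [glue_eT, glueBasis, Fin.ext_iff]
      · simp [glue_eT, glueBasis, Fin.ext_iff]
    · have hlast : Fin.last n ≠ 0 := by simp [Fin.ext_iff]; omega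
      rcases hy with rfl | rfl | rfl | rfl
      · exact of_L (lv_mem_Lsub hn)
      · exact of_R (rv_mem_Rsub hn)
      · rw [glue_eT, glueBasis, if_neg hlast]
      · rw [glue_eT, glueBasis, if_neg hlast]
    · obtain rfl := hy
      rw [glue_eT, glueBasis]
    · exact hy.elim

end Gluing

/-- **Chain-level gluing for the lax shuffle decomposition of the Gray cylinder over a
globe.**  For `n ≥ 3`, the inclusions exhibit `T = I ⊗ G(n+1)` as the colimit, in
chain complexes of abelian groups, of the zigzag `L ←֓ L∩M ↪ M ←֓ M∩R ↪ R`: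
for every chain complex `C` (a family of abelian groups `C m` with differentials
`dC m : C (m+1) → C m` squaring to zero) and chain maps `fL, fM, fR` from the
degreewise pieces of `L`, `M`, `R` to `C` (commuting with the differentials) such that
`fL` and `fM` agree on `L ∩ M` and `fM` and `fR` agree on `M ∩ R`, there exists a
unique chain map `f : T → C` restricting to `fL`, `fM`, `fR` on `L`, `M`, `R`. -/
theorem gray_cylinder_gluing (n : ℕ) (hn : 3 ≤ n)
    (C : ℕ → Type*) [∀ m, AddCommGroup (C m)] [∀ m, Module ℤ (C m)]
    (dC : ∀ m, C (m + 1) →ₗ[ℤ] C m)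
    (hdC : ∀ m (x : C (m + 2)), dC m (dC (m + 1) x) = 0)
    (fL : ∀ m, ↥(Lsub n ⊓ Tdeg n m) →ₗ[ℤ] C m)
    (fM : ∀ m, ↥(Msub n ⊓ Tdeg n m) →ₗ[ℤ] C m)
    (fR : ∀ m, ↥(Rsub n ⊓ Tdeg n m) →ₗ[ℤ] C m)
    (hfL : ∀ m (x : TT n) (hx : x ∈ Lsub n ⊓ Tdeg n (m + 1))
        (hdx : DT n x ∈ Lsub n ⊓ Tdeg n m),
        fL m ⟨DT n x, hdx⟩ = dC m (fL (m + 1) ⟨x, hx⟩))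
    (hfM : ∀ m (x : TT n) (hx : x ∈ Msub n ⊓ Tdeg n (m + 1))
        (hdx : DT n x ∈ Msub n ⊓ Tdeg n m),
        fM m ⟨DT n x, hdx⟩ = dC m (fM (m + 1) ⟨x, hx⟩))
    (hfR : ∀ m (x : TT n) (hx : x ∈ Rsub n ⊓ Tdeg n (m + 1))
        (hdx : DT n x ∈ Rsub n ⊓ Tdeg n m),
        fR m ⟨DT n x, hdx⟩ = dC m (fR (m + 1) ⟨x, hx⟩))
    (hLM : ∀ m (x : TT n) (h1 : x ∈ Lsub n ⊓ Tdeg n m) (h2 : x ∈ Msub n ⊓ Tdeg n m),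
        fL m ⟨x, h1⟩ = fM m ⟨x, h2⟩)
    (hMR : ∀ m (x : TT n) (h1 : x ∈ Msub n ⊓ Tdeg n m) (h2 : x ∈ Rsub n ⊓ Tdeg n m),
        fM m ⟨x, h1⟩ = fR m ⟨x, h2⟩) :
    ∃! f : ∀ m, ↥(Tdeg n m) →ₗ[ℤ] C m,
      (∀ m (x : TT n) (hx : x ∈ Tdeg n (m + 1)) (hdx : DT n x ∈ Tdeg n m),
          f m ⟨DT n x, hdx⟩ = dC m (f (m + 1) ⟨x, hx⟩)) ∧
      (∀ m (x : TT n) (hx : x ∈ Lsub n ⊓ Tdeg n m),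
          f m ⟨x, (Submodule.mem_inf.mp hx).2⟩ = fL m ⟨x, hx⟩) ∧
      (∀ m (x : TT n) (hx : x ∈ Msub n ⊓ Tdeg n m),
          f m ⟨x, (Submodule.mem_inf.mp hx).2⟩ = fM m ⟨x, hx⟩) ∧
      (∀ m (x : TT n) (hx : x ∈ Rsub n ⊓ Tdeg n m),
          f m ⟨x, (Submodule.mem_inf.mp hx).2⟩ = fR m ⟨x, hx⟩) := by
  have hn1 : 1 ≤ n := by omega
  let F (m : ℕ) : TT n →ₗ[ℤ] C m :=
    glue (extendByZero (fL m)) (extendByZero (fM m)) (extendByZero (fR m))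
  have hFL (m : ℕ) (x : TT n) (hx : x ∈ Lsub n ⊓ Tdeg n m) : F m x = fL m ⟨x, hx⟩ :=
    glue_eq_on_Lsub (fL m) hn1 _ _ x hx
  have hFM (m : ℕ) (x : TT n) (hx : x ∈ Msub n ⊓ Tdeg n m) : F m x = fM m ⟨x, hx⟩ :=
    glue_eq_on_Msub (fL m) (fM m) (fR m) (hLM m) (hMR m) hn1 x hx
  have hFR (m : ℕ) (x : TT n) (hx : x ∈ Rsub n ⊓ Tdeg n m) : F m x = fR m ⟨x, hx⟩ :=
    glue_eq_on_Rsub (fL m) (fM m) (fR m) (hLM m) (hMR m) hn1 x hx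
  have hF (m : ℕ) (x : TT n) (hx : x ∈ Tdeg n (m + 1)) :
      F m (DT n x) = dC m (F (m + 1) x) := by
    induction hx using Submodule.span_induction with
    | mem x h =>
      obtain ⟨b, hb, rfl⟩ := h
      have hbd := eT_mem_Tdeg hb
      have hdd : DT n (eT b) ∈ Tdeg n m := DT_eT b ▸ dTB_mem_Tdeg hb
      have hpiece := eT_mem_piece hn1 b
      rw [← DT_eT] at hpiece
      rcases hpiece with ⟨h, hd⟩ | ⟨h, hd⟩ | ⟨h, hd⟩
      · rw [hFL m _ (Submodule.mem_inf.mpr ⟨hd, hdd⟩),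
          hFL (m + 1) _ (Submodule.mem_inf.mpr ⟨h, hbd⟩), hfL]
      · rw [hFM m _ (Submodule.mem_inf.mpr ⟨hd, hdd⟩),
          hFM (m + 1) _ (Submodule.mem_inf.mpr ⟨h, hbd⟩), hfM]
      · rw [hFR m _ (Submodule.mem_inf.mpr ⟨hd, hdd⟩),
          hFR (m + 1) _ (Submodule.mem_inf.mpr ⟨h, hbd⟩), hfR]
    | zero => simp only [map_zero]
    | add x y _ _ hx hy => simp only [map_add, hx, hy]
    | smul a x _ hx => rw [LinearMap.map_smul, LinearMap.map_smul, hx, LinearMap.map_smul,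
        LinearMap.map_smul]
  refine ⟨fun m => (F m).comp (Tdeg n m).subtype,
    ⟨fun m x hx _ => hF m x hx, hFL, hFM, hFR⟩, ?_⟩
  rintro g ⟨-, hgL, hgM, hgR⟩
  funext m
  ext ⟨x, hx⟩
  refine (eq_of_eqOn_generators (g m) (F m) Submodule.subset_span le_rfl ?_ x hx).symm
  rintro _ ⟨b, hb, rfl⟩
  have hbd := eT_mem_Tdeg hb
  rw [extendByZero_of_mem (g m) hbd]
  rcases eT_mem_piece hn1 b with ⟨h, -⟩ | ⟨h, -⟩ | ⟨h, -⟩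
  · rw [hFL m _ (Submodule.mem_inf.mpr ⟨h, hbd⟩), ← hgL]
  · rw [hFM m _ (Submodule.mem_inf.mpr ⟨h, hbd⟩), ← hgM]
  · rw [hFR m _ (Submodule.mem_inf.mpr ⟨h, hbd⟩), ← hgR]
end
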